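/- Let N ≥ 1, λ > 0 and s ∈ ℝ^N with s_1 ≤ s_2 ≤ … ≤ s_N, and set s†_i := s_i − λ(2i − N − 1) for each i. If π† minimizes (1/2)Σ_{i=1}^N (π_i − s†_i)² over the set { π ∈ ℝ^N : π_1 ≤ π_2 ≤ … ≤ π_N }, then π† is a global minimizer of p_s over all of ℝ^N. -/

import Mathlib

noncomputable section

/-- The fused-lasso objective `p_s(π) = (1/2) Σ (π_i − s_i)² + λ Σ_{i<j} |π_i − π_j|`. -/
def pfun {N : ℕ} (lam : ℝ) (s π : Fin N → ℝ) : ℝ :=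
  (1 / 2) * ∑ i, (π i - s i) ^ 2 + lam * ∑ i, ∑ j, if i < j then |π i - π j| else 0

theorem pair_sum {N : ℕ} (π : Fin N → ℝ) :
    2 * (∑ i, ∑ j, if i < j then |π i - π j| else 0) = ∑ i, ∑ j, |π i - π j| := by
  have h1 : (∑ i, ∑ j, if i < j then |π i - π j| else 0)
      = ∑ i, ∑ j, if j < i then |π i - π j| else 0 := by
    rw [Finset.sum_comm]
    refine Finset.sum_congr rfl fun i _ => Finset.sum_congr rfl fun j _ => ?_
    rw [abs_sub_comm]
  rw [two_mul]
  nth_rewrite 2 [h1]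
  rw [← Finset.sum_add_distrib]
  refine Finset.sum_congr rfl fun i _ => ?_
  rw [← Finset.sum_add_distrib]
  refine Finset.sum_congr rfl fun j _ => ?_
  rcases lt_trichotomy i j with h | h | h
  · simp [h, h.not_gt]
  · simp [h]
  · simp [h, h.not_gt]

theorem mono_sum {N : ℕ} (π : Fin N → ℝ) (h : Monotone π) :
    (∑ i, ∑ j, if i < j then |π i - π j| else 0)
      = ∑ i : Fin N, ((2 * ((i : ℕ) + 1) : ℝ) - N - 1) * π i := by
  have h1 : (∑ i, ∑ j, if i < j then |π i - π j| else 0)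
      = (∑ j : Fin N, ∑ i : Fin N, if i < j then π j else 0)
        - ∑ i : Fin N, ∑ j : Fin N, if i < j then π i else 0 := by
    rw [Finset.sum_comm, Finset.sum_comm (f := fun i j : Fin N => if i < j then π i else 0),
      ← Finset.sum_sub_distrib]
    refine Finset.sum_congr rfl fun i _ => ?_
    rw [← Finset.sum_sub_distrib]
    refine Finset.sum_congr rfl fun j _ => ?_
    split_ifs with hij
    · rw [abs_sub_comm, abs_of_nonneg (sub_nonneg.2 (h hij.le))]
    · simp
  rw [h1, ← Finset.sum_sub_distrib]
  refine Finset.sum_congr rfl fun i _ => ?_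
  have e1 : (∑ j : Fin N, if j < i then π i else 0) = (i : ℕ) * π i := by
    rw [← Finset.sum_filter, Finset.sum_const, Finset.filter_gt_eq_Iio, Fin.card_Iio, nsmul_eq_mul]
  have e2 : (∑ j : Fin N, if i < j then π i else 0) = ((N : ℝ) - 1 - (i : ℕ)) * π i := by
    rw [← Finset.sum_filter, Finset.sum_const, Finset.filter_lt_eq_Ioi, Fin.card_Ioi, nsmul_eq_mul]
    have := i.2
    have e : N - 1 - (i : ℕ) = N - (i + 1) := by omega
    rw [e, Nat.cast_sub (by omega)]
    push_cast; ring
  rw [e1, e2]; ring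

theorem pfun_mono {N : ℕ} (lam : ℝ) (s sdag : Fin N → ℝ)
    (hsdag : ∀ i : Fin N, sdag i = s i - lam * ((2 * ((i : ℕ) + 1) : ℝ) - N - 1))
    (π : Fin N → ℝ) (h : Monotone π) :
    pfun lam s π = (1 / 2) * ∑ i, (π i - sdag i) ^ 2
      + (1 / 2) * ∑ i, (s i ^ 2 - sdag i ^ 2) := by
  unfold pfun
  rw [mono_sum π h, Finset.mul_sum, Finset.mul_sum, Finset.mul_sum, Finset.mul_sum,
    ← Finset.sum_add_distrib, ← Finset.sum_add_distrib]
  refine Finset.sum_congr rfl fun i _ => ?_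
  rw [hsdag i]; ring

theorem pfun_sort {N : ℕ} (lam : ℝ) (s : Fin N → ℝ) (hs : Monotone s) (π : Fin N → ℝ) :
    pfun lam s (π ∘ Tuple.sort π) ≤ pfun lam s π := by
  set σ := Tuple.sort π with hσ
  have hm : Monotone (π ∘ σ) := Tuple.monotone_sort π
  have ha : (∑ i, ∑ j, if i < j then |(π ∘ σ) i - (π ∘ σ) j| else 0)
      = ∑ i, ∑ j, if i < j then |π i - π j| else 0 := by
    have h2 : ∑ i, ∑ j, |(π ∘ σ) i - (π ∘ σ) j| = ∑ i, ∑ j, |π i - π j| := by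
      rw [← Equiv.sum_comp σ (fun i => ∑ j, |π i - π j|)]
      refine Finset.sum_congr rfl fun i _ => ?_
      exact Equiv.sum_comp σ (fun j => |π (σ i) - π j|)
    have := pair_sum π
    have := pair_sum (π ∘ σ)
    linarith
  have hr : ∑ i, π i * s i ≤ ∑ i, (π ∘ σ) i * s i := by
    have := (hm.monovary hs).sum_comp_perm_mul_le_sum_mul (σ := σ⁻¹)
    simpa using this
  have hq : ∑ i, (π ∘ σ) i ^ 2 = ∑ i, π i ^ 2 := Equiv.sum_comp σ (fun i => π i ^ 2)
  have ex : ∀ p : Fin N → ℝ, ∑ i, (p i - s i) ^ 2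
      = ∑ i, p i ^ 2 - 2 * ∑ i, p i * s i + ∑ i, s i ^ 2 := by
    intro p
    rw [Finset.mul_sum, ← Finset.sum_sub_distrib, ← Finset.sum_add_distrib]
    exact Finset.sum_congr rfl fun i _ => by ring
  unfold pfun
  rw [ha, ex, ex, hq]
  linarith

/-- if `s` is nondecreasing, `s†_i = s_i − λ(2i − N − 1)`, and `π†`
minimizes `(1/2) Σ (π_i − s†_i)²` over nondecreasing vectors, then `π†` is a global
minimizer of `p_s` over `ℝ^N` (1-based indices). -/
theorem stmt_16 {N : ℕ} (hN : 1 ≤ N) (lam : ℝ) (hlam : 0 < lam) (s : Fin N → ℝ)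
    (hs : Monotone s)
    (sdag : Fin N → ℝ)
    (hsdag : ∀ i : Fin N, sdag i = s i - lam * ((2 * ((i : ℕ) + 1) : ℝ) - N - 1))
    (πdag : Fin N → ℝ) (hmono : Monotone πdag)
    (hmin : ∀ π : Fin N → ℝ, Monotone π →
      (1 / 2) * ∑ i, (πdag i - sdag i) ^ 2 ≤ (1 / 2) * ∑ i, (π i - sdag i) ^ 2) :
    ∀ π : Fin N → ℝ, pfun lam s πdag ≤ pfun lam s π := by
  intro π
  refine le_trans ?_ (pfun_sort lam s hs π)
  have hm : Monotone (π ∘ Tuple.sort π) := Tuple.monotone_sort π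
  rw [pfun_mono lam s sdag hsdag _ hmono, pfun_mono lam s sdag hsdag _ hm]
  have := hmin _ hm
  linarith
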